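/- Let f be a minmax monotone cost function on a finite tree T_in, 𝒯 ≥ 0, and T = (V,E) a rooted working subtree with sink set S and hub tree T_{H(S)}. Let v ∈ V_{H(S)} be such that T(v) is RC-viable. Suppose there exists a child u of v in T_{H(S)} such that T(u) = T_{-v}(u) is recursively self-sufficient and some sink s ∈ S ∩ V_{-v}(u) satisfies f(BP(v,s), s) ≤ 𝒯, and suppose moreover that for every child u' of v in T_{H(S)}, T(u') = T_{-v}(u') is recursively self-sufficient. Then T(v) is recursively self-sufficient. -/

import Mathlib

open SimpleGraph Set
open scoped ENNReal

variable {V : Type*}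

/-- The vertex set of the connected component of the subgraph of `G` induced on `A`
containing the vertex `u` (empty if `u ∉ A`). -/
def reachSet (G : SimpleGraph V) (A : Set V) (u : V) : Set V :=
  {y | ∃ (hu : u ∈ A) (hy : y ∈ A), (G.induce A).Reachable ⟨u, hu⟩ ⟨y, hy⟩}

/-- `U` is a subtree: the induced subgraph on `U` is connected. -/
def IsSubtree (G : SimpleGraph V) (U : Set V) : Prop :=
  (G.induce U).Connected

/-- A minmax monotone cost function on the tree `G`:
`f {s} s = 0`; `f U s = ∞` if `U` is not a subtree or `s ∉ U`; set monotonicity;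
path monotonicity; and max tree composition (the slices of `U` defined by `s` being the
connected components of `U \ {s}`). -/
structure IsMinmaxMonotone (G : SimpleGraph V) (f : Set V → V → ℝ≥0∞) : Prop where
  singleton_eq_zero : ∀ s : V, f {s} s = 0
  eq_top_of_not_subtree : ∀ (U : Set V) (s : V), ¬ IsSubtree G U → f U s = ⊤
  eq_top_of_not_mem : ∀ (U : Set V) (s : V), s ∉ U → f U s = ⊤
  set_mono : ∀ (U₁ U₂ : Set V) (s : V), IsSubtree G U₁ → IsSubtree G U₂ →
    s ∈ U₁ → U₁ ⊆ U₂ → f U₁ s ≤ f U₂ s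
  path_mono : ∀ (U : Set V) (s u : V), IsSubtree G U → s ∉ U → u ∈ U → G.Adj s u →
    f U u ≤ f (U ∪ {s}) s
  max_comp : ∀ (U : Set V) (s : V), IsSubtree G U → s ∈ U →
    f U s = ⨆ x ∈ U \ {s}, f (reachSet G (U \ {s}) x ∪ {s}) s

/-- `s` is a leaf of the (working) tree induced on `W`. -/
def IsLeafOf (G : SimpleGraph V) (W : Set V) (s : V) : Prop :=
  s ∈ W ∧ ∃! u, u ∈ W ∧ G.Adj s u

/-- The ordered pair `(u,v)` satisfies the peaking criterion in the working tree on `W`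
with sink set `S` and threshold `𝒯`. -/
def PeakingPair (G : SimpleGraph V) (f : Set V → V → ℝ≥0∞) (𝒯 : ℝ≥0∞)
    (W S : Set V) (u v : V) : Prop :=
  u ∈ W ∧ v ∈ W ∧ G.Adj u v ∧ S ∩ reachSet G (W \ {v}) u = ∅ ∧
    f (reachSet G (W \ {v}) u) u ≤ 𝒯 ∧ 𝒯 < f (reachSet G (W \ {v}) u ∪ {v}) v

/-- `w` lies on the unique path from `a` to `b` in the tree induced on `W`. -/
def OnPath (G : SimpleGraph V) (W : Set V) (a b w : V) : Prop :=
  a ∈ W ∧ b ∈ W ∧ w ∈ W ∧ b ∉ reachSet G (W \ {w}) a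

/-- Vertices of the hub tree: union of the paths from the sinks to the root `r`. -/
def hubVerts (G : SimpleGraph V) (W S : Set V) (r : V) : Set V :=
  {w | ∃ s ∈ S, OnPath G W s r w}

/-- `r` is a valid root: a non-sink vertex of the working tree such that at least two of
the subtrees hanging off it contain sinks. -/
def GoodRoot (G : SimpleGraph V) (W S : Set V) (r : V) : Prop :=
  r ∈ W ∧ r ∉ S ∧
    ∃ η₁ η₂ : V, η₁ ≠ η₂ ∧ η₁ ∈ W ∧ η₂ ∈ W ∧ G.Adj r η₁ ∧ G.Adj r η₂ ∧
      (S ∩ reachSet G (W \ {r}) η₁).Nonempty ∧ (S ∩ reachSet G (W \ {r}) η₂).Nonempty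

/-- The working tree on `W` is RC-viable w.r.t. sinks `S` and root `r`: every outstanding
branch, together with the hub-tree node it is attached to, has cost at most `𝒯`. -/
def RCViable (G : SimpleGraph V) (f : Set V → V → ℝ≥0∞) (𝒯 : ℝ≥0∞)
    (W S : Set V) (r : V) : Prop :=
  ∀ w ∈ hubVerts G W S r, ∀ η ∈ W, G.Adj w η → η ∉ hubVerts G W S r →
    f (reachSet G (W \ {w}) η ∪ {w}) w ≤ 𝒯

/-- The set `A` is self-sufficient: it can be partitioned into subtree blocks, one for
each sink in `S ∩ A`, each block containing its sink and having cost at most `𝒯`. -/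
def SelfSufficient (G : SimpleGraph V) (f : Set V → V → ℝ≥0∞) (𝒯 : ℝ≥0∞)
    (S A : Set V) : Prop :=
  ∃ P : V → Set V,
    (⋃ s ∈ S ∩ A, P s) = A ∧
    (∀ s ∈ S ∩ A, IsSubtree G (P s) ∧ s ∈ P s ∧ f (P s) s ≤ 𝒯) ∧
    (S ∩ A).Pairwise fun s t => Disjoint (P s) (P t)

/-- The vertices of the path `Π(a,b)` in the tree induced on `W`. -/
def pathSet (G : SimpleGraph V) (W : Set V) (a b : V) : Set V :=
  {w | OnPath G W a b w}

/-- All vertices of outstanding branches attached to `w` (given hub-tree vertices `Hub`). -/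
def branchesAt (G : SimpleGraph V) (W Hub : Set V) (w : V) : Set V :=
  ⋃ η ∈ {η : V | η ∈ W ∧ G.Adj w η ∧ η ∉ Hub}, reachSet G (W \ {w}) η

/-- The bulk path `BP(a,b)`: the path `Π(a,b)` together with all outstanding branches
attached to its vertices. -/
def bulkPath (G : SimpleGraph V) (W S : Set V) (r a b : V) : Set V :=
  pathSet G W a b ∪ ⋃ w ∈ pathSet G W a b, branchesAt G W (hubVerts G W S r) w

/-- `v` is the parent of `u` in the hub tree rooted at `r`. -/
def HubParent (G : SimpleGraph V) (W S : Set V) (r u v : V) : Prop :=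
  u ∈ hubVerts G W S r ∧ v ∈ hubVerts G W S r ∧ G.Adj u v ∧ OnPath G W u r v

/-- The ordered pair `(u,v)` satisfies the reaching criterion: `v` is the hub-tree parent
of `u`, `T₋ᵥ(u)` is self-sufficient, and `BP(v,v) ∪ V₋ᵥ(u)` is not self-sufficient. -/
def ReachingPair (G : SimpleGraph V) (f : Set V → V → ℝ≥0∞) (𝒯 : ℝ≥0∞)
    (W S : Set V) (r u v : V) : Prop :=
  HubParent G W S r u v ∧
  SelfSufficient G f 𝒯 S (reachSet G (W \ {v}) u) ∧
  ¬ SelfSufficient G f 𝒯 S (bulkPath G W S r v v ∪ reachSet G (W \ {v}) u)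

/-- The vertex set `V(v)` of the subtree of the working tree (rooted at `r`) rooted at `v`:
all vertices whose path to the root passes through `v`. -/
def rootedBelow (G : SimpleGraph V) (W : Set V) (r v : V) : Set V :=
  {x | OnPath G W x r v}

/-- The rooted subtree `T(v)` is RC-viable: every outstanding branch attached to a
hub-tree node lying in `T(v)` has, together with its attachment node, cost at most `𝒯`. -/
def RCViableBelow (G : SimpleGraph V) (f : Set V → V → ℝ≥0∞) (𝒯 : ℝ≥0∞)
    (W S : Set V) (r v : V) : Prop :=
  ∀ w ∈ hubVerts G W S r ∩ rootedBelow G W r v, ∀ η ∈ W, G.Adj w η →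
    η ∉ hubVerts G W S r → f (reachSet G (W \ {w}) η ∪ {w}) w ≤ 𝒯

/-- The subtree with vertex set `A` (of the working tree rooted at `r`) is recursively
self-sufficient: for every hub-tree node `w` in `A`, the part of `A` lying below `w`
is self-sufficient. -/
def RecursivelySelfSufficientOn (G : SimpleGraph V) (f : Set V → V → ℝ≥0∞) (𝒯 : ℝ≥0∞)
    (W S : Set V) (r : V) (A : Set V) : Prop :=
  ∀ w ∈ hubVerts G W S r ∩ A, SelfSufficient G f 𝒯 S (rootedBelow G W r w ∩ A)

/-- A feasible sink configuration: a partition of all of `V_in` into subtree blocks,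
one per sink, each block containing exactly its own sink and having cost at most `𝒯`. -/
def IsFeasibleConfig (G : SimpleGraph V) (f : Set V → V → ℝ≥0∞) (𝒯 : ℝ≥0∞)
    (St : Set V) (P : V → Set V) : Prop :=
  (⋃ s ∈ St, P s) = Set.univ ∧
  St.Pairwise (fun s t => Disjoint (P s) (P t)) ∧
  ∀ s ∈ St, IsSubtree G (P s) ∧ St ∩ P s = {s} ∧ f (P s) s ≤ 𝒯

/-- An optimal feasible sink configuration: one with the minimum number of sinks. -/
def IsOptimalConfig (G : SimpleGraph V) (f : Set V → V → ℝ≥0∞) (𝒯 : ℝ≥0∞)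
    (St : Set V) (P : V → Set V) : Prop :=
  IsFeasibleConfig G f 𝒯 St P ∧
  ∀ (St' : Set V) (P' : V → Set V), IsFeasibleConfig G f 𝒯 St' P' → St.ncard ≤ St'.ncard

/-- A partial sink configuration relative to the working tree on `W`: pairwise disjoint
subtree blocks of cost at most `𝒯`, one per sink of `Sout`, covering `V_in \ (W \ Sout)`. -/
def IsPartialConfig (G : SimpleGraph V) (f : Set V → V → ℝ≥0∞) (𝒯 : ℝ≥0∞)
    (W : Set V) (Sout : Set V) (P : V → Set V) : Prop :=
  Sout.Pairwise (fun s t => Disjoint (P s) (P t)) ∧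
  (∀ s ∈ Sout, IsSubtree G (P s) ∧ s ∈ P s ∧ f (P s) s ≤ 𝒯) ∧
  (⋃ s ∈ Sout, P s) = Set.univ \ (W \ Sout)

/-- `(St, Pt)` is an optimal feasible sink configuration witnessing the optimality of the
partial configuration `(Sout, P)` relative to the working tree on `W` (conditions (C1)-(C3)). -/
def WitnessesOptimality (G : SimpleGraph V) (f : Set V → V → ℝ≥0∞) (𝒯 : ℝ≥0∞)
    (W : Set V) (Sout : Set V) (P : V → Set V) (St : Set V) (Pt : V → Set V) : Prop :=
  IsOptimalConfig G f 𝒯 St Pt ∧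
  Sout ⊆ St ∧
  St \ W = Sout \ W ∧
  (∀ s ∈ Sout ∩ W, IsLeafOf G W s) ∧
  (∀ s ∈ St, s ∉ W → Pt s = P s ∧ Pt s ∩ W = ∅) ∧
  (∀ s ∈ Sout ∩ W, P s ⊆ Pt s ∧ Pt s \ P s ⊆ W) ∧
  (∀ s ∈ St, s ∉ Sout → Pt s ⊆ W)

/-- The partial sink configuration `(Sout, P)` is optimal relative to the working tree on `W`. -/
def OptimalRelative (G : SimpleGraph V) (f : Set V → V → ℝ≥0∞) (𝒯 : ℝ≥0∞)
    (W : Set V) (Sout : Set V) (P : V → Set V) : Prop :=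
  ∃ (St : Set V) (Pt : V → Set V), WitnessesOptimality G f 𝒯 W Sout P St Pt

section RootedOrder

variable {G : SimpleGraph V} {A W S : Set V} {r x y z h k : V}

theorem mem_reachSet_iff_exists_walk :
    y ∈ reachSet G A x ↔ ∃ p : G.Walk x y, ∀ z ∈ p.support, z ∈ A := by
  constructor
  · rintro ⟨hx, hy, ⟨p⟩⟩
    refine ⟨p.map (Embedding.induce A).toHom, fun z hz => ?_⟩
    have hz' : z ∈ p.support.map (Embedding.induce (G := G) A).toHom := by
      rw [← Walk.support_map]
      exact hz
    obtain ⟨a, -, rfl⟩ := List.mem_map.1 hz'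
    exact a.2
  · rintro ⟨p, hp⟩
    exact ⟨hp _ p.start_mem_support, hp _ p.end_mem_support, ⟨p.induce A hp⟩⟩

theorem mem_reachSet_self (hx : x ∈ A) : x ∈ reachSet G A x :=
  ⟨hx, hx, Reachable.refl _⟩

theorem reachSet_symm (h : y ∈ reachSet G A x) : x ∈ reachSet G A y := by
  obtain ⟨hx, hy, h⟩ := h
  exact ⟨hy, hx, h.symm⟩

theorem reachSet_trans (h₁ : y ∈ reachSet G A x) (h₂ : z ∈ reachSet G A y) :
    z ∈ reachSet G A x := by
  obtain ⟨hx, _, h₁⟩ := h₁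
  obtain ⟨_, hz, h₂⟩ := h₂
  exact ⟨hx, hz, h₁.trans h₂⟩

theorem mem_reachSet_of_adj (hxy : G.Adj x y) (hx : x ∈ A) (hy : y ∈ A) :
    y ∈ reachSet G A x :=
  ⟨hx, hy, Adj.reachable (G := G.induce A) (induce_adj.2 hxy)⟩

theorem isSubtree_of_forall_mem_reachSet (hx : x ∈ A) (h : ∀ y ∈ A, x ∈ reachSet G A y) :
    IsSubtree G A :=
  (connected_iff_exists_forall_reachable _).2 ⟨⟨x, hx⟩, fun y => (h y y.2).2.2.symm⟩

theorem IsSubtree.exists_isPath (hW : IsSubtree G W) (hx : x ∈ W) (hy : y ∈ W) :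
    ∃ p : G.Walk x y, p.IsPath ∧ ∀ z ∈ p.support, z ∈ W := by
  classical
  obtain ⟨p, hp⟩ := mem_reachSet_iff_exists_walk.1
    (⟨hx, hy, hW.preconnected _ _⟩ : y ∈ reachSet G W x)
  exact ⟨p.bypass, p.bypass_isPath, fun z hz => hp z (p.support_bypass_subset_support hz)⟩

theorem OnPath.mem_support (h : OnPath G W x y z) (p : G.Walk x y)
    (hp : ∀ w ∈ p.support, w ∈ W) : z ∈ p.support := by
  by_contra hz
  exact h.2.2.2 (mem_reachSet_iff_exists_walk.2
    ⟨p, fun w hw => ⟨hp w hw, fun e => hz ((e : w = z) ▸ hw)⟩⟩)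

theorem onPath_start (hx : x ∈ W) (hr : r ∈ W) : OnPath G W x r x :=
  ⟨hx, hr, hx, fun h => h.1.2 rfl⟩

theorem OnPath.trans (h₁ : OnPath G W x r y) (h₂ : OnPath G W y r z) :
    OnPath G W x r z := by
  classical
  refine ⟨h₁.1, h₁.2.1, h₂.2.2.1, fun hr => ?_⟩
  obtain ⟨p, hp⟩ := mem_reachSet_iff_exists_walk.1 hr
  have hy := h₁.mem_support p fun w hw => (hp w hw).1
  exact h₂.2.2.2 (mem_reachSet_iff_exists_walk.2
    ⟨p.dropUntil y hy, fun w hw => hp w (p.support_dropUntil_subset_support hy hw)⟩)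

theorem OnPath.antisymm (hW : IsSubtree G W) (h₁ : OnPath G W x r y) (h₂ : OnPath G W y r x) :
    x = y := by
  classical
  by_contra hne
  obtain ⟨p, hp, hpW⟩ := hW.exists_isPath h₁.1 h₁.2.1
  have hy := h₁.mem_support p hpW
  cases p with
  | nil => simp at hy; exact hne hy.symm
  | cons hadj q =>
    rw [Walk.cons_isPath_iff] at hp
    have hyq : y ∈ q.support := by
      rw [Walk.support_cons, List.mem_cons] at hy
      exact hy.resolve_left (Ne.symm hne)
    have hsub := q.support_dropUntil_subset_support hyq
    exact hp.2 (hsub (h₂.mem_support (q.dropUntil y hyq)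
      fun w hw => hpW w (by simp [hsub hw])))

theorem exists_parent (hG : G.IsTree) (hW : IsSubtree G W) (hx : x ∈ W) (hr : r ∈ W)
    (hne : x ≠ r) :
    ∃ y ∈ W, G.Adj x y ∧ OnPath G W x r y ∧ ∀ h, OnPath G W x r h → h = x ∨ OnPath G W y r h := by
  classical
  obtain ⟨p, hp, hpW⟩ := hW.exists_isPath hx hr
  cases p with
  | nil => exact absurd rfl hne
  | @cons _ y _ hadj q =>
    have hyW : y ∈ W := hpW y (by simp)
    refine ⟨y, hyW, hadj, ⟨hx, hr, hyW, fun hreach => ?_⟩, fun h hh => ?_⟩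
    · obtain ⟨w, hw⟩ := mem_reachSet_iff_exists_walk.1 hreach
      have heq : w.bypass = Walk.cons hadj q :=
        congrArg Subtype.val ((hG.isAcyclic.subsingleton_path x r).elim
          ⟨_, w.bypass_isPath⟩ ⟨_, hp⟩)
      have hy : y ∈ w.bypass.support := by rw [heq]; simp
      exact (hw y (w.support_bypass_subset_support hy)).2 rfl
    · by_cases hhx : h = x
      · exact Or.inl hhx
      · refine Or.inr ⟨hyW, hr, hh.2.2.1, fun hreach => hh.2.2.2 ?_⟩
        exact reachSet_trans (mem_reachSet_of_adj hadj ⟨hx, Ne.symm hhx⟩ hreach.1) hreach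

/-- Induction along the path from a vertex towards the root. -/
theorem rooted_induction [Finite V] (hG : G.IsTree) (hW : IsSubtree G W) (hr : r ∈ W)
    {motive : V → Prop} (root : motive r)
    (step : ∀ x ∈ W, ∀ y ∈ W, x ≠ r → G.Adj x y → OnPath G W x r y →
      (∀ h, OnPath G W x r h → h = x ∨ OnPath G W y r h) → motive y → motive x)
    (x : V) (hx : x ∈ W) : motive x := by
  induction hn : {h | OnPath G W x r h}.ncard using Nat.strong_induction_on generalizing x with
  | _ n ih =>
    by_cases hxr : x = r
    · exact hxr ▸ root
    · obtain ⟨y, hy, hadj, hxy, hup⟩ := exists_parent hG hW hx hr hxr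
      refine step x hx y hy hxr hadj hxy hup (ih _ ?_ y hy rfl)
      rw [← hn]
      refine Set.ncard_lt_ncard ⟨fun h hh => hxy.trans hh, fun hsub => ?_⟩ (Set.toFinite _)
      exact hadj.ne (hxy.antisymm hW (hsub (onPath_start hx hr)))

theorem onPath_end_iff (hr : r ∈ W) : OnPath G W r r x ↔ x = r := by
  constructor
  · intro h
    by_contra hne
    exact h.2.2.2 (mem_reachSet_self ⟨hr, Ne.symm hne⟩)
  · rintro rfl
    exact onPath_start hr hr

theorem OnPath.total [Finite V] (hG : G.IsTree) (hW : IsSubtree G W)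
    (h₁ : OnPath G W x r h) (h₂ : OnPath G W x r k) :
    OnPath G W h r k ∨ OnPath G W k r h := by
  have hr := h₁.2.1
  refine rooted_induction hG hW hr
    (motive := fun x => OnPath G W x r h → OnPath G W x r k →
      OnPath G W h r k ∨ OnPath G W k r h) ?_ ?_ x h₁.1 h₁ h₂
  · intro h₁ h₂
    rw [onPath_end_iff hr] at h₁ h₂
    subst h₁ h₂
    exact Or.inl (onPath_start hr hr)
  · intro x hx y hy _ _ _ hup ih h₁ h₂
    rcases hup _ h₁ with rfl | h₁'
    · exact Or.inl h₂
    rcases hup _ h₂ with rfl | h₂'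
    · exact Or.inr h₁
    exact ih h₁' h₂'

theorem exists_child [Finite V] (hG : G.IsTree) (hW : IsSubtree G W)
    (hxv : OnPath G W x r y) (hne : x ≠ y) :
    ∃ z, OnPath G W x r z ∧ OnPath G W z r y ∧ G.Adj z y := by
  have hr := hxv.2.1
  refine rooted_induction hG hW hr
    (motive := fun x => OnPath G W x r y → x ≠ y →
      ∃ z, OnPath G W x r z ∧ OnPath G W z r y ∧ G.Adj z y) ?_ ?_ x hxv.1 hxv hne
  · intro h hne
    exact absurd ((onPath_end_iff hr).1 h).symm hne
  · intro x hx p _ _ hadj hxp hup ih hxy hne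
    by_cases hpy : p = y
    · subst hpy
      exact ⟨x, onPath_start hx hr, hxp, hadj⟩
    · obtain ⟨z, h₁, h₂, h₃⟩ := ih ((hup _ hxy).resolve_left (Ne.symm hne)) hpy
      exact ⟨z, hxp.trans h₁, h₂, h₃⟩

theorem OnPath.eq_of_isLeafOf [Finite V] (hG : G.IsTree) (hW : IsSubtree G W)
    (hy : IsLeafOf G W y) (hyr : y ≠ r) (hxy : OnPath G W x r y) : x = y := by
  by_contra hne
  have hr := hxy.2.1
  obtain ⟨z, -, hzy, hadj⟩ := exists_child hG hW hxy hne
  obtain ⟨p, hp, hyp, hyp', -⟩ := exists_parent hG hW hy.1 hr hyr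
  have hzp : z = p := hy.2.unique ⟨hzy.1, hadj.symm⟩ ⟨hp, hyp⟩
  exact hadj.ne (hzy.antisymm hW (hzp ▸ hyp'))

theorem OnPath.of_between (hW : IsSubtree G W) {s v w : V} (hsw : OnPath G W s r w)
    (hwv : OnPath G W w r v) : OnPath G W v s w := by
  refine ⟨hwv.2.2.1, hsw.1, hwv.1, fun hreach => hsw.2.2.2 ?_⟩
  refine reachSet_trans (reachSet_symm hreach) ?_
  by_contra hr
  exact hreach.1.2 (OnPath.antisymm hW ⟨hreach.1.1, hsw.2.1, hwv.1, hr⟩ hwv)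

theorem mem_hubVerts_of_onPath (hh : h ∈ hubVerts G W S r)
    (hhk : OnPath G W h r k) : k ∈ hubVerts G W S r := by
  obtain ⟨s, hs, hsh⟩ := hh
  exact ⟨s, hs, hsh.trans hhk⟩

theorem exists_mem_branchesAt [Finite V] (hG : G.IsTree) (hW : IsSubtree G W) {v : V}
    (hv : v ∈ hubVerts G W S r) (hxv : OnPath G W x r v) (hx : x ∉ hubVerts G W S r) :
    ∃ h ∈ hubVerts G W S r, OnPath G W x r h ∧ OnPath G W h r v ∧
      x ∈ branchesAt G W (hubVerts G W S r) h := by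
  have hr := hxv.2.1
  suffices H : ∃ h ∈ hubVerts G W S r, OnPath G W x r h ∧ OnPath G W h r v ∧
      ∃ η ∈ W, G.Adj h η ∧ η ∉ hubVerts G W S r ∧ x ∈ reachSet G (W \ {h}) η by
    obtain ⟨h, hh, hxh, hhv, η, hη, hadj, hηh, hreach⟩ := H
    exact ⟨h, hh, hxh, hhv, Set.mem_biUnion (show η ∈ {η | _} from ⟨hη, hadj, hηh⟩) hreach⟩
  refine rooted_induction hG hW hr
    (motive := fun x => OnPath G W x r v → x ∉ hubVerts G W S r →
      ∃ h ∈ hubVerts G W S r, OnPath G W x r h ∧ OnPath G W h r v ∧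
      ∃ η ∈ W, G.Adj h η ∧ η ∉ hubVerts G W S r ∧ x ∈ reachSet G (W \ {h}) η)
    ?_ ?_ x hxv.1 hxv hx
  · intro h hr'
    exact absurd ((onPath_end_iff hr).1 h ▸ hv) hr'
  · intro x hxW y hyW _ hadj hxy hup ih hxv hx
    have hyv : OnPath G W y r v :=
      (hup _ hxv).resolve_left fun e => hx (e ▸ hv)
    by_cases hy : y ∈ hubVerts G W S r
    · exact ⟨y, hy, hxy, hyv, x, hxW, hadj.symm, hx, mem_reachSet_self ⟨hxW, hadj.ne⟩⟩
    · obtain ⟨h, hh, hyh, hhv, η, hη, hadj', hηh, hreach⟩ := ih hyv hy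
      refine ⟨h, hh, hxy.trans hyh, hhv, η, hη, hadj', hηh, reachSet_trans hreach ?_⟩
      refine mem_reachSet_of_adj hadj.symm hreach.2.1 ⟨hxW, fun e => hx ?_⟩
      exact (e : x = h) ▸ hh

/-- The vertices below `v` all of whose hub-tree ancestors are ancestors of `s`. -/
def bulkBelow (G : SimpleGraph V) (W S : Set V) (r v s : V) : Set V :=
  {x | OnPath G W x r v ∧ ∀ h ∈ hubVerts G W S r, OnPath G W x r h → OnPath G W s r h}

theorem bulkBelow_subset_bulkPath [Finite V] (hG : G.IsTree) (hW : IsSubtree G W) {v s : V}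
    (hv : v ∈ hubVerts G W S r) : bulkBelow G W S r v s ⊆ bulkPath G W S r v s := by
  rintro x ⟨hxv, hx⟩
  by_cases hxh : x ∈ hubVerts G W S r
  · exact Or.inl (OnPath.of_between hW (hx x hxh (onPath_start hxv.1 hxv.2.1)) hxv)
  · obtain ⟨h, hh, hxh', hhv, hbr⟩ := exists_mem_branchesAt hG hW hv hxv hxh
    exact Or.inr (Set.mem_biUnion
      (show h ∈ pathSet G W v s from OnPath.of_between hW (hx h hh hxh') hhv) hbr)

theorem isSubtree_bulkBelow [Finite V] (hG : G.IsTree) (hW : IsSubtree G W) {v s : V}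
    (hsv : OnPath G W s r v) : IsSubtree G (bulkBelow G W S r v s) := by
  have hr := hsv.2.1
  have hvB : v ∈ bulkBelow G W S r v s :=
    ⟨onPath_start hsv.2.2.1 hr, fun h _ hvh => hsv.trans hvh⟩
  refine isSubtree_of_forall_mem_reachSet hvB fun y hy => ?_
  refine rooted_induction hG hW hr
    (motive := fun y => y ∈ bulkBelow G W S r v s →
      v ∈ reachSet G (bulkBelow G W S r v s) y) ?_ ?_ y hy.1.1 hy
  · intro h
    have hvr := (onPath_end_iff hr).1 h.1
    subst hvr
    exact mem_reachSet_self hvB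
  · intro x hx p hp _ hadj hxp hup ih hxB
    rcases hup _ hxB.1 with rfl | hpv
    · exact mem_reachSet_self hvB
    · have hpB : p ∈ bulkBelow G W S r v s :=
        ⟨hpv, fun h hh hph => hxB.2 h hh (hxp.trans hph)⟩
      exact reachSet_trans (mem_reachSet_of_adj hadj hxB hpB) (ih hpB)

/-- `c` is a maximal hub-tree vertex below `v` that is not an ancestor of `s`. -/
def HangsOff (G : SimpleGraph V) (W S : Set V) (r v s c : V) : Prop :=
  c ∈ hubVerts G W S r ∧ OnPath G W c r v ∧ ¬ OnPath G W s r c ∧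
    ∀ k, OnPath G W c r k → OnPath G W k r v → ¬ OnPath G W s r k → k = c

theorem exists_hangsOff [Finite V] (hG : G.IsTree) (hW : IsSubtree G W) {v s : V}
    (hsv : OnPath G W s r v) (hxv : OnPath G W x r v) (hx : x ∉ bulkBelow G W S r v s) :
    ∃ c, HangsOff G W S r v s c ∧ OnPath G W x r c := by
  have hr := hsv.2.1
  obtain ⟨h, hh, hxh, hsh⟩ : ∃ h ∈ hubVerts G W S r, OnPath G W x r h ∧ ¬ OnPath G W s r h := by
    by_contra! H
    exact hx ⟨hxv, H⟩
  have hhv : OnPath G W h r v :=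
    (hxh.total hG hW hxv).resolve_right fun hvh => hsh (hsv.trans hvh)
  suffices H : ∃ c, HangsOff G W S r v s c ∧ OnPath G W h r c by
    obtain ⟨c, hc, hhc⟩ := H
    exact ⟨c, hc, hxh.trans hhc⟩
  refine rooted_induction hG hW hr
    (motive := fun h => h ∈ hubVerts G W S r → OnPath G W h r v → ¬ OnPath G W s r h →
      ∃ c, HangsOff G W S r v s c ∧ OnPath G W h r c) ?_ ?_ h hhv.1 hh hhv hsh
  · intro _ h hsr
    exact absurd ((onPath_end_iff hr).1 h ▸ hsv) hsr
  · intro h hhW y hy _ _ hhy hup ih hh hhv hsh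
    have hyv := (hup _ hhv).resolve_left fun e => hsh (e ▸ hsv)
    by_cases hsy : OnPath G W s r y
    · refine ⟨h, ⟨hh, hhv, hsh, fun k hhk _ hsk => ?_⟩, onPath_start hhW hr⟩
      exact (hup _ hhk).resolve_right fun hyk => hsk (hsy.trans hyk)
    · obtain ⟨c, hc, hyc⟩ := ih (mem_hubVerts_of_onPath hh hhy) hyv hsy
      exact ⟨c, hc, hhy.trans hyc⟩

theorem HangsOff.eq [Finite V] (hG : G.IsTree) (hW : IsSubtree G W) {v s c d : V}
    (hc : HangsOff G W S r v s c) (hd : HangsOff G W S r v s d)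
    (hxc : OnPath G W x r c) (hxd : OnPath G W x r d) : c = d := by
  rcases hxc.total hG hW hxd with h | h
  · exact (hc.2.2.2 d h hd.2.1 hd.2.2.1).symm
  · exact hd.2.2.2 c h hc.2.1 hc.2.2.1

theorem rootedBelow_subset_of_onPath (h : OnPath G W x r y) :
    rootedBelow G W r x ⊆ rootedBelow G W r y :=
  fun _ hz => OnPath.trans hz h

/-- Adding the block `bulkBelow` of `s` to partitions of the subtrees hanging off it. -/
theorem selfSufficient_rootedBelow [Finite V] (hG : G.IsTree) (hW : IsSubtree G W)
    {f : Set V → V → ℝ≥0∞} {𝒯 : ℝ≥0∞} {v s : V}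
    (hmin : ∀ t ∈ S, ∀ y, OnPath G W y r t → y = t)
    (hs : s ∈ S) (hsv : OnPath G W s r v) (hcost : f (bulkBelow G W S r v s) s ≤ 𝒯)
    (hoff : ∀ c, HangsOff G W S r v s c → SelfSufficient G f 𝒯 S (rootedBelow G W r c)) :
    SelfSufficient G f 𝒯 S (rootedBelow G W r v) := by
  classical
  have hr := hsv.2.1
  have htop : ∀ t, t ∈ S ∩ rootedBelow G W r v → t ≠ s →
      ∃ c, HangsOff G W S r v s c ∧ OnPath G W t r c := by
    rintro t ⟨htS, htv⟩ hts
    have ht := onPath_start (G := G) (htv.1) hr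
    exact exists_hangsOff hG hW hsv htv fun htB =>
      hts (hmin t htS s (htB.2 t ⟨t, htS, ht⟩ ht)).symm
  choose! top htop₁ htop₂ using htop
  choose! P hP₁ hP₂ hP₃ using hoff
  have hsub : ∀ c, HangsOff G W S r v s c → ∀ t ∈ S ∩ rootedBelow G W r c,
      P c t ⊆ rootedBelow G W r c := fun c hc t ht => by
    conv_rhs => rw [← hP₁ c hc]
    exact Set.subset_biUnion_of_mem (u := fun t => P c t) ht
  let Q : V → Set V := fun t => if t = s then bulkBelow G W S r v s else P (top t) t
  have hQs : Q s = bulkBelow G W S r v s := if_pos rfl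
  have hQ : ∀ t, t ≠ s → Q t = P (top t) t := fun t ht => if_neg ht
  have hbulk : ∀ t ∈ S ∩ rootedBelow G W r v, t ≠ s → Disjoint (Q s) (Q t) := by
    intro t ht hts
    rw [hQs, hQ t hts, Set.disjoint_left]
    intro x hxB hx
    have hc := htop₁ t ht hts
    exact hc.2.2.1 (hxB.2 _ hc.1 (hsub _ hc t ⟨ht.1, htop₂ t ht hts⟩ hx))
  refine ⟨Q, ?_, ?_, ?_⟩
  · apply Set.Subset.antisymm
    · refine Set.iUnion₂_subset fun t ht => ?_
      by_cases hts : t = s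
      · subst hts
        rw [hQs]
        exact fun x hx => hx.1
      · rw [hQ t hts]
        have hc := htop₁ t ht hts
        exact (hsub _ hc t ⟨ht.1, htop₂ t ht hts⟩).trans (rootedBelow_subset_of_onPath hc.2.1)
    · intro x hxv
      by_cases hxB : x ∈ bulkBelow G W S r v s
      · exact Set.mem_biUnion (x := s) ⟨hs, hsv⟩ (hQs ▸ hxB)
      · obtain ⟨c, hc, hxc⟩ := exists_hangsOff hG hW hsv hxv hxB
        have hx : x ∈ ⋃ t ∈ S ∩ rootedBelow G W r c, P c t := by
          rw [hP₁ c hc]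
          exact hxc
        obtain ⟨t, ht, hxt⟩ := Set.mem_iUnion₂.1 hx
        have htv : t ∈ S ∩ rootedBelow G W r v := ⟨ht.1, OnPath.trans ht.2 hc.2.1⟩
        have hts : t ≠ s := by
          rintro rfl
          exact hc.2.2.1 ht.2
        have htc := (htop₁ t htv hts).eq hG hW hc (htop₂ t htv hts) ht.2
        refine Set.mem_biUnion htv ?_
        rw [hQ t hts, htc]
        exact hxt
  · intro t ht
    by_cases hts : t = s
    · subst hts
      rw [hQs]
      exact ⟨isSubtree_bulkBelow hG hW hsv, ⟨hsv, fun _ _ h => h⟩, hcost⟩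
    · rw [hQ t hts]
      exact hP₂ _ (htop₁ t ht hts) t ⟨ht.1, htop₂ t ht hts⟩
  · intro t ht t' ht' hne
    by_cases hts : t = s
    · subst hts
      exact hbulk t' ht' (Ne.symm hne)
    by_cases hts' : t' = s
    · subst hts'
      exact (hbulk t ht hts).symm
    have hc := htop₁ t ht hts
    have hc' := htop₁ t' ht' hts'
    have htc : t ∈ S ∩ rootedBelow G W r (top t) := ⟨ht.1, htop₂ t ht hts⟩
    have htc' : t' ∈ S ∩ rootedBelow G W r (top t') := ⟨ht'.1, htop₂ t' ht' hts'⟩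
    rw [hQ t hts, hQ t' hts']
    by_cases heq : top t = top t'
    · rw [heq] at htc hc ⊢
      exact hP₃ _ hc htc htc' hne
    · rw [Set.disjoint_left]
      intro x hx hx'
      exact heq (hc.eq hG hW hc' (hsub _ hc t htc hx) (hsub _ hc' t' htc' hx'))

end RootedOrder

/-- Lemma `RecursiveSS` (2): under the hypotheses of part (1), if moreover
every hub-tree child `u'` of `v` has `T(u') = T₋ᵥ(u')` recursively self-sufficient, then
`T(v)` itself is recursively self-sufficient. -/
theorem statement_8 [Fintype V] (G : SimpleGraph V) (hG : G.IsTree)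
    (f : Set V → V → ℝ≥0∞) (hf : IsMinmaxMonotone G f) (𝒯 : ℝ≥0∞)
    (W S : Set V) (hW : IsSubtree G W) (hSW : S ⊆ W)
    (hSleaf : ∀ s ∈ S, IsLeafOf G W s)
    (r : V) (hS2 : 2 ≤ S.ncard) (hW2 : 2 < W.ncard) (hroot : GoodRoot G W S r)
    (v : V) (hv : v ∈ hubVerts G W S r)
    (hRCv : RCViableBelow G f 𝒯 W S r v)
    (u : V) (hchild : HubParent G W S r u v)
    (hrec : RecursivelySelfSufficientOn G f 𝒯 W S r (rootedBelow G W r u))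
    (s : V) (hs : s ∈ S ∩ reachSet G (W \ {v}) u)
    (hbp : f (bulkPath G W S r v s) s ≤ 𝒯)
    (hall : ∀ u' : V, HubParent G W S r u' v →
      RecursivelySelfSufficientOn G f 𝒯 W S r (rootedBelow G W r u')) :
    RecursivelySelfSufficientOn G f 𝒯 W S r (rootedBelow G W r v) := by
  have hr : r ∈ W := hroot.1
  have hsS : s ∈ S := hs.1
  have hmin : ∀ t ∈ S, ∀ y, OnPath G W y r t → y = t := fun t ht y hyt =>
    hyt.eq_of_isLeafOf hG hW (hSleaf t ht) fun e : t = r => hroot.2.1 (e ▸ ht)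
  have hsv : OnPath G W s r v :=
    ⟨hSW hsS, hr, hchild.2.2.2.2.2.1, fun hreach =>
      hchild.2.2.2.2.2.2 (reachSet_trans hs.2 hreach)⟩
  have hsub := bulkBelow_subset_bulkPath (s := s) hG hW hv
  have hcost : f (bulkBelow G W S r v s) s ≤ 𝒯 := by
    refine le_trans ?_ hbp
    by_cases hbt : IsSubtree G (bulkPath G W S r v s)
    · exact hf.set_mono _ _ s (isSubtree_bulkBelow hG hW hsv) hbt ⟨hsv, fun _ _ h => h⟩ hsub
    · rw [hf.eq_top_of_not_subtree _ s hbt]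
      exact le_top
  have hbelow : ∀ w ∈ hubVerts G W S r, OnPath G W w r v → w ≠ v →
      SelfSufficient G f 𝒯 S (rootedBelow G W r w) := by
    intro w hw hwv hne
    obtain ⟨z, hwz, hzv, hadj⟩ := exists_child hG hW hwv hne
    have h := hall z ⟨mem_hubVerts_of_onPath hw hwz, hv, hadj, hzv⟩ w ⟨hw, hwz⟩
    rwa [Set.inter_eq_left.2 (rootedBelow_subset_of_onPath hwz)] at h
  rintro w ⟨hw, hwv⟩
  rw [Set.inter_eq_left.2 (rootedBelow_subset_of_onPath hwv)]
  by_cases hne : w = v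
  · subst hne
    exact selfSufficient_rootedBelow hG hW hmin hsS hsv hcost fun c hc =>
      hbelow c hc.1 hc.2.1 fun e => hc.2.2.1 (e ▸ hsv)
  · exact hbelow w hw hwv hne
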